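/- Assume Θ is compact and g(x,β) is differentiable with respect to β for all x. For the normal–truncated-normal pseudo conditional density and for the normal–exponential pseudo conditional density, for every α > 0 there exists a constant C, not depending on x, y or θ, such that for all θ ∈ Θ and all (x,y), ‖∂_θ H_α(x,y;θ)‖ ≤ C (1 + ‖∂_β g(x,β)‖). -/

import Mathlib

open MeasureTheory ProbabilityTheory Real Set Filter

/-- The standard normal density φ(t) = (2π)^{-1/2} e^{-t²/2}. -/
noncomputable def stdGaussPdf (t : ℝ) : ℝ := (Real.sqrt (2 * Real.pi))⁻¹ * Real.exp (-(t ^ 2) / 2)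

/-- The standard normal cumulative distribution function Φ. -/
noncomputable def stdGaussCdf (t : ℝ) : ℝ := ∫ s in Set.Iic t, stdGaussPdf s

/-- The normal–truncated-normal pseudo conditional density
f_θ(y|x) = (1/σ)[1−Φ(−μ/σ_u)]⁻¹ φ((y−g(x,β)+μ)/σ) Φ(μ/(σλ) − λ(y−g(x,β))/σ),
with σ² = σ_v² + σ_u², λ = σ_u/σ_v, and θ = (β, μ, σ_v, σ_u). -/
noncomputable def fNT {p q : ℕ} (g : (Fin p → ℝ) → (Fin q → ℝ) → ℝ)
    (θ : (Fin q → ℝ) × ℝ × ℝ × ℝ) (x : Fin p → ℝ) (y : ℝ) : ℝ :=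
  let β := θ.1; let μ := θ.2.1; let σv := θ.2.2.1; let σu := θ.2.2.2
  let σ := Real.sqrt (σv ^ 2 + σu ^ 2)
  let lam := σu / σv
  σ⁻¹ * (1 - stdGaussCdf (-(μ / σu)))⁻¹ * stdGaussPdf ((y - g x β + μ) / σ) *
    stdGaussCdf (μ / (σ * lam) - lam * (y - g x β) / σ)

/-- The normal–exponential pseudo conditional density
f_θ(y|x) = (1/σ_u) Φ(−(y−g(x,β))/σ_v − σ_v/σ_u) exp((y−g(x,β))/σ_u + σ_v²/(2σ_u²)),
with θ = (β, σ_v, σ_u). -/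
noncomputable def fNE {p q : ℕ} (g : (Fin p → ℝ) → (Fin q → ℝ) → ℝ)
    (θ : (Fin q → ℝ) × ℝ × ℝ) (x : Fin p → ℝ) (y : ℝ) : ℝ :=
  let β := θ.1; let σv := θ.2.1; let σu := θ.2.2
  σu⁻¹ * stdGaussCdf (-((y - g x β) / σv) - σv / σu) *
    Real.exp ((y - g x β) / σu + σv ^ 2 / (2 * σu ^ 2))

/-- The objective function H_α(x,y;θ) = ∫ f_θ^{1+α}(y'|x) dy' − (1+1/α) f_θ^α(y|x)
of the minimum density power divergence estimator. -/
noncomputable def dpdH {P XS : Type*} (a : ℝ) (f : P → XS → ℝ → ℝ)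
    (θ : P) (x : XS) (y : ℝ) : ℝ :=
  (∫ y' : ℝ, f θ x y' ^ (1 + a)) - (1 + 1 / a) * f θ x y ^ a

/-- The compact parameter box Θ = [b̲,b̄]^q × [u̲,ū] × [σ̲,σ̄]² of the
normal–truncated-normal specification. -/
def boxNT (q : ℕ) (bl bu ul uu sl su : ℝ) : Set ((Fin q → ℝ) × ℝ × ℝ × ℝ) :=
  (Set.Icc (fun _ => bl) (fun _ => bu)) ×ˢ ((Set.Icc ul uu) ×ˢ ((Set.Icc sl su) ×ˢ (Set.Icc sl su)))

/-- The compact parameter box Θ = [b̲,b̄]^q × [σ̲,σ̄]² of the normal–exponential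
specification. -/
def boxNE (q : ℕ) (bl bu sl su : ℝ) : Set ((Fin q → ℝ) × ℝ × ℝ) :=
  (Set.Icc (fun _ => bl) (fun _ => bu)) ×ˢ ((Set.Icc sl su) ×ˢ (Set.Icc sl su))

lemma stdGaussPdf_eq_gaussianPDFReal : stdGaussPdf = gaussianPDFReal 0 1 := by
  funext t
  simp [stdGaussPdf, gaussianPDFReal]

lemma stdGaussPdf_pos (t : ℝ) : 0 < stdGaussPdf t := by
  unfold stdGaussPdf
  positivity

lemma continuous_stdGaussPdf : Continuous stdGaussPdf := by
  unfold stdGaussPdf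
  fun_prop

lemma integrable_stdGaussPdf : Integrable stdGaussPdf := by
  rw [stdGaussPdf_eq_gaussianPDFReal]
  exact integrable_gaussianPDFReal 0 1

lemma integral_stdGaussPdf : ∫ t, stdGaussPdf t = 1 := by
  rw [stdGaussPdf_eq_gaussianPDFReal]
  exact integral_gaussianPDFReal_eq_one 0 one_ne_zero

lemma stdGaussCdf_pos (z : ℝ) : 0 < stdGaussCdf z := by
  unfold stdGaussCdf
  rw [setIntegral_pos_iff_support_of_nonneg_ae
    (ae_of_all _ fun t => (stdGaussPdf_pos t).le) integrable_stdGaussPdf.integrableOn]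
  have : Function.support stdGaussPdf = univ := by
    ext t
    simp [(stdGaussPdf_pos t).ne']
  simp [this]

lemma stdGaussCdf_lt_one (z : ℝ) : stdGaussCdf z < 1 := by
  have h : 0 < ∫ t in Ioi z, stdGaussPdf t := by
    rw [setIntegral_pos_iff_support_of_nonneg_ae
      (ae_of_all _ fun t => (stdGaussPdf_pos t).le) integrable_stdGaussPdf.integrableOn]
    have : Function.support stdGaussPdf = univ := by
      ext t
      simp [(stdGaussPdf_pos t).ne']
    simp [this]
  have h2 := intervalIntegral.integral_Iic_add_Ioi (b := z)
    integrable_stdGaussPdf.integrableOn integrable_stdGaussPdf.integrableOn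
  rw [integral_stdGaussPdf] at h2
  unfold stdGaussCdf
  linarith

lemma stdGaussCdf_sub (z w : ℝ) : stdGaussCdf w - stdGaussCdf z = ∫ t in z..w, stdGaussPdf t :=
  intervalIntegral.integral_Iic_sub_Iic integrable_stdGaussPdf.integrableOn
    integrable_stdGaussPdf.integrableOn

lemma hasDerivAt_stdGaussCdf (z : ℝ) : HasDerivAt stdGaussCdf (stdGaussPdf z) z := by
  have h : HasDerivAt (fun w => stdGaussCdf 0 + ∫ t in (0 : ℝ)..w, stdGaussPdf t)
      (stdGaussPdf z) z :=
    (continuous_stdGaussPdf.integral_hasStrictDerivAt 0 z).hasDerivAt.const_add _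
  convert h using 2 with w
  rw [← stdGaussCdf_sub]
  ring

@[fun_prop]
lemma contDiff_stdGaussCdf : ContDiff ℝ 1 stdGaussCdf := by
  rw [contDiff_one_iff_deriv]
  refine ⟨fun z => (hasDerivAt_stdGaussCdf z).differentiableAt, ?_⟩
  rw [show deriv stdGaussCdf = stdGaussPdf from
    funext fun z => (hasDerivAt_stdGaussCdf z).deriv]
  exact continuous_stdGaussPdf

/-- A bound on the inverse Mills ratio. -/
lemma stdGaussPdf_le_mul_stdGaussCdf (z : ℝ) :
    stdGaussPdf z ≤ exp 2 * (1 + |z|) * stdGaussCdf z := by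
  set h : ℝ := (1 + |z|)⁻¹ with hh
  have hz := abs_nonneg z
  have hh0 : 0 < h := by positivity
  have hh1 : h ≤ 1 := inv_le_one_of_one_le₀ (by linarith)
  have hhz : |z| * h ≤ 1 := by
    rw [hh, ← div_eq_mul_inv, div_le_one (by positivity)]
    linarith
  have hlow : ∀ t ∈ Icc (z - h) z, exp (-2) * stdGaussPdf z ≤ stdGaussPdf t := by
    intro t ht
    unfold stdGaussPdf
    rw [mul_left_comm, ← exp_add]
    gcongr
    have h1 : |t - z| ≤ h := by
      rw [abs_le]
      constructor <;> linarith [ht.1, ht.2]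
    have h2 : z * (t - z) ≤ 1 := by
      calc z * (t - z) ≤ |z * (t - z)| := le_abs_self _
        _ = |z| * |t - z| := abs_mul _ _
        _ ≤ |z| * h := by gcongr
        _ ≤ 1 := hhz
    have h3 : (t - z) ^ 2 ≤ 1 := by
      rw [← sq_abs]
      exact pow_le_one₀ (abs_nonneg _) (h1.trans hh1)
    nlinarith
  have hint : h * (exp (-2) * stdGaussPdf z) ≤ ∫ t in (z - h)..z, stdGaussPdf t := by
    have := intervalIntegral.integral_mono_on (μ := volume) (a := z - h) (b := z) (by linarith)
      intervalIntegrable_const (continuous_stdGaussPdf.intervalIntegrable _ _) hlow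
    rwa [intervalIntegral.integral_const, smul_eq_mul, sub_sub_cancel] at this
  have hle : h * (exp (-2) * stdGaussPdf z) ≤ stdGaussCdf z := by
    rw [← stdGaussCdf_sub] at hint
    linarith [stdGaussCdf_pos (z - h)]
  calc stdGaussPdf z
      = exp 2 * (1 + |z|) * (h * (exp (-2) * stdGaussPdf z)) := by
        rw [hh, exp_neg]
        field_simp
    _ ≤ _ := by gcongr

lemma stdGaussCdf_le_exp {z : ℝ} (hz : z ≤ 0) : stdGaussCdf z ≤ exp (-(z ^ 2) / 2) := by
  unfold stdGaussCdf
  have hi : Integrable fun t => exp (-(z ^ 2) / 2) * stdGaussPdf (t - z) :=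
    (integrable_stdGaussPdf.comp_sub_right z).const_mul _
  calc ∫ t in Iic z, stdGaussPdf t
      ≤ ∫ t in Iic z, exp (-(z ^ 2) / 2) * stdGaussPdf (t - z) := by
        refine setIntegral_mono_on integrable_stdGaussPdf.integrableOn hi.integrableOn
          measurableSet_Iic fun t ht => ?_
        unfold stdGaussPdf
        rw [mul_left_comm, ← exp_add]
        gcongr
        have : t ≤ z := ht
        nlinarith
    _ ≤ ∫ t, exp (-(z ^ 2) / 2) * stdGaussPdf (t - z) :=
        setIntegral_le_integral hi
          (ae_of_all _ fun t => mul_nonneg (exp_pos _).le (stdGaussPdf_pos _).le)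
    _ = exp (-(z ^ 2) / 2) := by
        rw [integral_const_mul, integral_sub_right_eq_self, integral_stdGaussPdf, mul_one]

lemma abs_log_stdGaussCdf_sub_le (z w : ℝ) :
    |log (stdGaussCdf w) - log (stdGaussCdf z)| ≤ exp 2 * (1 + |z| + |w|) * |w - z| := by
  refine Convex.norm_image_sub_le_of_norm_hasDerivWithin_le (s := uIcc z w)
    (f := fun t => log (stdGaussCdf t)) (f' := fun t => stdGaussPdf t / stdGaussCdf t)
    (fun t _ => ((hasDerivAt_stdGaussCdf t).log (stdGaussCdf_pos t).ne').hasDerivWithinAt)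
    (fun t ht => ?_) (convex_uIcc z w) left_mem_uIcc right_mem_uIcc
  rw [norm_of_nonneg (div_nonneg (stdGaussPdf_pos t).le (stdGaussCdf_pos t).le),
    div_le_iff₀ (stdGaussCdf_pos t)]
  have ht' : |t| ≤ |z| + |w| := by
    have h1 := abs_le_max_abs_abs (a := min z w) (b := t) (c := max z w) ht.1 ht.2
    refine h1.trans (max_le ?_ ?_)
    · rcases min_choice z w with h | h <;> rw [h] <;> linarith [abs_nonneg z, abs_nonneg w]
    · rcases max_choice z w with h | h <;> rw [h] <;> linarith [abs_nonneg z, abs_nonneg w]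
  refine (stdGaussPdf_le_mul_stdGaussCdf t).trans ?_
  have h2 : 1 + |t| ≤ 1 + |z| + |w| := by linarith
  have := (stdGaussCdf_pos t).le
  gcongr

lemma exists_lipschitz_bounded {E : Type*} [NormedAddCommGroup E] [NormedSpace ℝ E]
    {K : Set E} (hK : IsCompact K) {c : E → ℝ} (hc : ∀ p ∈ K, ContDiffAt ℝ 1 c p) :
    ∃ L : ℝ, 0 ≤ L ∧ (∀ p ∈ K, |c p| ≤ L) ∧
      ∀ p ∈ K, ∀ p' ∈ K, |c p - c p'| ≤ L * ‖p - p'‖ := by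
  have hcont : ContinuousOn c K := fun p hp => (hc p hp).continuousAt.continuousWithinAt
  obtain ⟨M, hM⟩ := hK.exists_bound_of_continuousOn hcont
  have hloc : LocallyLipschitzOn K c := fun p hp => by
    obtain ⟨L, t, ht, hL⟩ := (hc p hp).exists_lipschitzOnWith
    exact ⟨L, t, mem_nhdsWithin_of_mem_nhds ht, hL⟩
  obtain ⟨L, hL⟩ := hloc.exists_lipschitzOnWith_of_compact hK
  refine ⟨max L M, le_max_of_le_left L.2, fun p hp => (hM p hp).trans (le_max_right _ _),
    fun p hp p' hp' => ?_⟩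
  have := hL.norm_sub_le hp hp'
  rw [Real.norm_eq_abs] at this
  exact this.trans (by gcongr; exact le_max_left _ _)

/-- A log-quadratic function of `r` times a normal cdf of an affine function of `r` has a
logarithm whose Lipschitz constant grows at most quadratically in `r`, uniformly for the
coefficients' parameter in a compact set. -/
lemma exists_abs_log_sub_le {E : Type*} [NormedAddCommGroup E] [NormedSpace ℝ E]
    {K : Set E} (hK : IsCompact K) {c₀ c₁ c₂ a b : E → ℝ}
    (hc₀ : ∀ p ∈ K, ContDiffAt ℝ 1 c₀ p) (hc₁ : ∀ p ∈ K, ContDiffAt ℝ 1 c₁ p)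
    (hc₂ : ∀ p ∈ K, ContDiffAt ℝ 1 c₂ p) (ha : ∀ p ∈ K, ContDiffAt ℝ 1 a p)
    (hb : ∀ p ∈ K, ContDiffAt ℝ 1 b p) {k : ℝ → E → ℝ}
    (hk : ∀ p ∈ K, ∀ r, k r p =
      exp (c₀ p + c₁ p * r + c₂ p * r ^ 2) * stdGaussCdf (a p + b p * r)) :
    ∃ A : ℝ, 0 ≤ A ∧ ∀ p ∈ K, ∀ p' ∈ K, ∀ r r' : ℝ,
      |log (k r p) - log (k r' p')| ≤ A * (1 + |r| + |r'|) ^ 2 * (|r - r'| + ‖p - p'‖) := by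
  obtain ⟨L₀, hL₀, hB₀, hD₀⟩ := exists_lipschitz_bounded hK hc₀
  obtain ⟨L₁, hL₁, hB₁, hD₁⟩ := exists_lipschitz_bounded hK hc₁
  obtain ⟨L₂, hL₂, hB₂, hD₂⟩ := exists_lipschitz_bounded hK hc₂
  obtain ⟨La, hLa, hBa, hDa⟩ := exists_lipschitz_bounded hK ha
  obtain ⟨Lb, hLb, hBb, hDb⟩ := exists_lipschitz_bounded hK hb
  refine ⟨L₀ + L₁ + L₂ + exp 2 * (1 + 2 * (La + Lb)) * (La + Lb), by positivity,
    fun p hp p' hp' r r' => ?_⟩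
  set D := |r - r'| + ‖p - p'‖ with hD
  set R := 1 + |r| + |r'| with hR
  have hr := abs_nonneg r
  have hr' := abs_nonneg r'
  have hdp := norm_nonneg (p - p')
  have hdr := abs_nonneg (r - r')
  have hD0 : 0 ≤ D := by positivity
  have hR1 : 1 ≤ R := by linarith
  have hR2 : R ≤ R ^ 2 := by nlinarith
  have key : ∀ u u' v v' L S : ℝ, 0 ≤ L → |u'| ≤ L → |u - u'| ≤ L * ‖p - p'‖ →
      |v| ≤ S → |v - v'| ≤ S * |r - r'| → |u * v - u' * v'| ≤ L * S * D := by
    intro u u' v v' L S hL hu hdu hv hdv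
    have e : u * v - u' * v' = (u - u') * v + u' * (v - v') := by ring
    calc |u * v - u' * v'| ≤ |u - u'| * |v| + |u'| * |v - v'| := by
          rw [e, ← abs_mul, ← abs_mul]
          exact abs_add_le _ _
      _ ≤ L * ‖p - p'‖ * S + L * (S * |r - r'|) := by gcongr
      _ = L * S * D := by rw [hD]; ring
  have h0 : |c₀ p - c₀ p'| ≤ L₀ * R ^ 2 * D := by
    calc |c₀ p - c₀ p'| ≤ L₀ * ‖p - p'‖ := hD₀ p hp p' hp'
      _ ≤ L₀ * R ^ 2 * D := by
        have : ‖p - p'‖ ≤ D := by linarith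
        have : L₀ * 1 ≤ L₀ * R ^ 2 := by gcongr; nlinarith
        calc L₀ * ‖p - p'‖ = L₀ * 1 * ‖p - p'‖ := by ring
          _ ≤ _ := by gcongr
  have h1 : |c₁ p * r - c₁ p' * r'| ≤ L₁ * R ^ 2 * D := by
    refine key _ _ _ _ _ _ hL₁ (hB₁ p' hp') (hD₁ p hp p' hp') (by linarith) ?_
    nlinarith
  have h2 : |c₂ p * r ^ 2 - c₂ p' * r' ^ 2| ≤ L₂ * R ^ 2 * D := by
    refine key _ _ _ _ _ _ hL₂ (hB₂ p' hp') (hD₂ p hp p' hp') ?_ ?_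
    · rw [abs_pow]
      gcongr
      linarith
    · have e : r ^ 2 - r' ^ 2 = (r + r') * (r - r') := by ring
      rw [e, abs_mul]
      gcongr
      linarith [abs_add_le r r']
  set z := a p + b p * r with hz
  set z' := a p' + b p' * r' with hz'
  have hzb : ∀ q ∈ K, ∀ ρ, |ρ| ≤ R → |a q + b q * ρ| ≤ (La + Lb) * R := by
    intro q hq ρ hρ
    calc |a q + b q * ρ| ≤ |a q| + |b q| * |ρ| := by
          rw [← abs_mul]
          exact abs_add_le _ _
      _ ≤ La * R + Lb * R := by
          have := hBa q hq
          have := hBb q hq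
          have : La * 1 ≤ La * R := by gcongr
          gcongr
          linarith
      _ = _ := by ring
  have hzd : |z - z'| ≤ (La + Lb) * R * D := by
    have e : z - z' = (a p - a p') + (b p * r - b p' * r') := by rw [hz, hz']; ring
    have hb1 : |b p * r - b p' * r'| ≤ Lb * R * D :=
      key _ _ _ _ _ _ hLb (hBb p' hp') (hDb p hp p' hp') (by linarith) (by nlinarith)
    have ha1 : |a p - a p'| ≤ La * R * D := by
      calc |a p - a p'| ≤ La * ‖p - p'‖ := hDa p hp p' hp'
        _ = La * 1 * ‖p - p'‖ := by ring
        _ ≤ La * R * D := by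
          have : ‖p - p'‖ ≤ D := by linarith
          gcongr
    calc |z - z'| ≤ |a p - a p'| + |b p * r - b p' * r'| := by
          rw [e]
          exact abs_add_le _ _
      _ ≤ _ := by linarith
  have h3 : |log (stdGaussCdf z) - log (stdGaussCdf z')| ≤
      exp 2 * (1 + 2 * (La + Lb)) * (La + Lb) * R ^ 2 * D := by
    have := hzb p hp r (by linarith)
    have := hzb p' hp' r' (by linarith)
    calc |log (stdGaussCdf z) - log (stdGaussCdf z')|
        ≤ exp 2 * (1 + |z'| + |z|) * |z - z'| := abs_log_stdGaussCdf_sub_le z' z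
      _ ≤ exp 2 * (R + (La + Lb) * R + (La + Lb) * R) * ((La + Lb) * R * D) := by
          gcongr
      _ = _ := by ring
  rw [hk p hp, hk p' hp', log_mul (exp_pos _).ne' (stdGaussCdf_pos _).ne',
    log_mul (exp_pos _).ne' (stdGaussCdf_pos _).ne', log_exp, log_exp]
  rw [abs_le] at *
  constructor <;> linarith [h0.1, h0.2, h1.1, h1.2, h2.1, h2.2, h3.1, h3.2]

lemma abs_rpow_sub_rpow_le {x y s : ℝ} (hx : 0 < x) (hy : 0 < y) (hs : 0 ≤ s) :
    |x ^ s - y ^ s| ≤ s * (x ^ s + y ^ s) * |log x - log y| := by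
  have key : ∀ u v : ℝ, 0 < u → 0 < v → u ^ s - v ^ s ≤ s * (u ^ s + v ^ s) * |log u - log v| := by
    intro u v hu hv
    have hu' := rpow_pos_of_pos hu s
    have hv' := rpow_pos_of_pos hv s
    have h1 : v ^ s = u ^ s * exp (s * (log v - log u)) := by
      rw [rpow_def_of_pos hu, rpow_def_of_pos hv, ← exp_add]
      ring_nf
    have h2 := add_one_le_exp (s * (log v - log u))
    have h3 : u ^ s - v ^ s ≤ u ^ s * (s * |log u - log v|) := by
      calc u ^ s - v ^ s = u ^ s * (1 - exp (s * (log v - log u))) := by rw [h1]; ring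
        _ ≤ u ^ s * (s * |log u - log v|) := by
          gcongr
          nlinarith [le_abs_self (log u - log v)]
    have h4 : 0 ≤ v ^ s * (s * |log u - log v|) := by positivity
    linarith
  rw [abs_le]
  refine ⟨?_, key x y hx hy⟩
  have := key y x hy hx
  rw [abs_sub_comm, add_comm] at this
  linarith

lemma exists_exp_neg_mul_abs_mul_sq_le {c : ℝ} (hc : 0 < c) :
    ∃ M : ℝ, 0 ≤ M ∧ ∀ r : ℝ, exp (-(c * |r|)) * (1 + |r|) ^ 2 ≤ M * (1 + r ^ 2)⁻¹ := by
  refine ⟨24 * exp c / c ^ 4, by positivity, fun r => ?_⟩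
  have hr := abs_nonneg r
  have h1 := pow_div_factorial_le_exp (c * (1 + |r|)) (by positivity) 4
  have h2 : exp (c * (1 + |r|)) = exp c * exp (c * |r|) := by
    rw [← exp_add]
    ring_nf
  have h3 : (1 + |r|) ^ 2 * (1 + r ^ 2) ≤ (1 + |r|) ^ 4 := by
    have : 1 + r ^ 2 ≤ (1 + |r|) ^ 2 := by nlinarith [sq_abs r]
    calc (1 + |r|) ^ 2 * (1 + r ^ 2) ≤ (1 + |r|) ^ 2 * (1 + |r|) ^ 2 := by gcongr
      _ = _ := by ring
  have h4 : (1 + |r|) ^ 4 ≤ 24 * exp c / c ^ 4 * exp (c * |r|) := by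
    rw [h2, mul_pow] at h1
    norm_num [Nat.factorial] at h1
    rw [div_mul_eq_mul_div, le_div_iff₀ (by positivity)]
    linarith
  rw [← div_eq_mul_inv, le_div_iff₀ (by positivity), exp_neg, mul_assoc,
    inv_mul_le_iff₀ (exp_pos _)]
  linarith

lemma exists_abs_rpow_sub_le {E : Type*} [NormedAddCommGroup E] {K : Set E} {k : ℝ → E → ℝ}
    (hpos : ∀ p ∈ K, ∀ r, 0 < k r p) {B c : ℝ} (hc : 0 < c)
    (hdecay : ∀ p ∈ K, ∀ r, k r p ≤ B * exp (-(c * |r|))) {A : ℝ} (hA : 0 ≤ A)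
    (hlog : ∀ p ∈ K, ∀ p' ∈ K, ∀ r r' : ℝ,
      |log (k r p) - log (k r' p')| ≤ A * (1 + |r| + |r'|) ^ 2 * (|r - r'| + ‖p - p'‖))
    {s : ℝ} (hs : 0 < s) :
    ∃ M : ℝ, 0 ≤ M ∧ (∀ p ∈ K, ∀ r, k r p ^ s ≤ M * (1 + r ^ 2)⁻¹) ∧
      ∀ p ∈ K, ∀ p' ∈ K, ∀ r r' : ℝ, |r - r'| ≤ 1 →
        |k r p ^ s - k r' p' ^ s| ≤ M * (1 + r ^ 2)⁻¹ * (|r - r'| + ‖p - p'‖) := by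
  rcases K.eq_empty_or_nonempty with rfl | ⟨p₀, hp₀⟩
  · exact ⟨0, le_rfl, by simp, by simp⟩
  have hB : 0 ≤ B := (pos_of_mul_pos_left ((hpos p₀ hp₀ 0).trans_le (hdecay p₀ hp₀ 0))
    (exp_pos _).le).le
  obtain ⟨M, hM, hMr⟩ := exists_exp_neg_mul_abs_mul_sq_le (mul_pos hc hs)
  have hpow : ∀ p ∈ K, ∀ r, k r p ^ s ≤ B ^ s * exp (-(c * s * |r|)) := by
    intro p hp r
    calc k r p ^ s ≤ (B * exp (-(c * |r|))) ^ s :=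
          rpow_le_rpow (hpos p hp r).le (hdecay p hp r) hs.le
      _ = B ^ s * exp (-(c * s * |r|)) := by
          rw [mul_rpow hB (exp_pos _).le, ← exp_mul]
          ring_nf
  have hBs : 0 ≤ B ^ s := rpow_nonneg hB s
  refine ⟨max (B ^ s * M) (s * (B ^ s * (1 + exp (c * s))) * (A * 4) * M),
    le_max_of_le_left (by positivity), fun p hp r => ?_, fun p hp p' hp' r r' hrr => ?_⟩
  · have hr := abs_nonneg r
    calc k r p ^ s ≤ B ^ s * (exp (-(c * s * |r|)) * 1) := by simpa using hpow p hp r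
      _ ≤ B ^ s * (exp (-(c * s * |r|)) * (1 + |r|) ^ 2) := by
          gcongr
          nlinarith
      _ ≤ B ^ s * (M * (1 + r ^ 2)⁻¹) := mul_le_mul_of_nonneg_left (hMr r) hBs
      _ = B ^ s * M * (1 + r ^ 2)⁻¹ := by ring
      _ ≤ _ := by gcongr; exact le_max_left _ _
  · have hr := abs_nonneg r
    have hr' : |r| - 1 ≤ |r'| ∧ |r'| ≤ |r| + 1 := by
      have := abs_le.1 ((abs_abs_sub_abs_le r r').trans hrr)
      constructor <;> linarith
    have he : exp (-(c * s * |r'|)) ≤ exp (c * s) * exp (-(c * s * |r|)) := by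
      rw [← exp_add]
      gcongr
      have : 0 < c * s := by positivity
      nlinarith
    have hsum : k r p ^ s + k r' p' ^ s ≤ B ^ s * (1 + exp (c * s)) * exp (-(c * s * |r|)) := by
      have h1 := hpow p hp r
      have h2 := (hpow p' hp' r').trans (mul_le_mul_of_nonneg_left he hBs)
      linarith
    have hR : (1 + |r| + |r'|) ^ 2 ≤ 4 * (1 + |r|) ^ 2 := by
      nlinarith [abs_nonneg r']
    calc |k r p ^ s - k r' p' ^ s|
        ≤ s * (k r p ^ s + k r' p' ^ s) * |log (k r p) - log (k r' p')| :=
          abs_rpow_sub_rpow_le (hpos p hp r) (hpos p' hp' r') hs.le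
      _ ≤ s * (B ^ s * (1 + exp (c * s)) * exp (-(c * s * |r|))) *
          (A * (4 * (1 + |r|) ^ 2) * (|r - r'| + ‖p - p'‖)) := by
          gcongr
          exact (hlog p hp p' hp' r r').trans (by gcongr)
      _ = s * (B ^ s * (1 + exp (c * s))) * (A * 4) *
          (exp (-(c * s * |r|)) * (1 + |r|) ^ 2) * (|r - r'| + ‖p - p'‖) := by ring
      _ ≤ s * (B ^ s * (1 + exp (c * s))) * (A * 4) * (M * (1 + r ^ 2)⁻¹) *
          (|r - r'| + ‖p - p'‖) :=
          mul_le_mul_of_nonneg_right (mul_le_mul_of_nonneg_left (hMr r) (by positivity))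
            (by positivity)
      _ = s * (B ^ s * (1 + exp (c * s))) * (A * 4) * M * (1 + r ^ 2)⁻¹ *
          (|r - r'| + ‖p - p'‖) := by ring
      _ ≤ _ := by gcongr; exact le_max_right _ _

/-- The score bound for a location family `k (y - g x β) p` whose kernel `k` decays exponentially
and has a logarithm with quadratically growing Lipschitz constant. -/
theorem exists_norm_fderiv_dpdH_le {X V E : Type*} [NormedAddCommGroup V] [NormedSpace ℝ V]
    [NormedAddCommGroup E] [NormedSpace ℝ E] {g : X → V → ℝ}
    (hg : ∀ x, Differentiable ℝ (g x)) {α : ℝ} (hα : 0 < α) {K N : Set E}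
    (hN : ∀ p ∈ N, K ∈ nhds p) {k : ℝ → E → ℝ} (hpos : ∀ p ∈ K, ∀ r, 0 < k r p)
    (hcont : ∀ p ∈ K, Continuous fun r => k r p) {B c : ℝ} (hc : 0 < c)
    (hdecay : ∀ p ∈ K, ∀ r, k r p ≤ B * exp (-(c * |r|))) {A : ℝ} (hA : 0 ≤ A)
    (hlog : ∀ p ∈ K, ∀ p' ∈ K, ∀ r r' : ℝ,
      |log (k r p) - log (k r' p')| ≤ A * (1 + |r| + |r'|) ^ 2 * (|r - r'| + ‖p - p'‖)) :
    ∃ C : ℝ, ∀ θ : V × E, θ.2 ∈ N → ∀ (x : X) (y : ℝ),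
      ‖fderiv ℝ (fun t : V × E => dpdH α (fun t x y => k (y - g x t.1) t.2) t x y) θ‖ ≤
        C * (1 + ‖fderiv ℝ (g x) θ.1‖) := by
  obtain ⟨M, hM, hMb, hMd⟩ := exists_abs_rpow_sub_le hpos hc hdecay hA hlog hα
  obtain ⟨M', hM', hMb', hMd'⟩ :=
    exists_abs_rpow_sub_le hpos hc hdecay hA hlog (s := 1 + α) (by positivity)
  have hint : ∀ p ∈ K, Integrable fun r => k r p ^ (1 + α) := by
    intro p hp
    refine (integrable_inv_one_add_sq.const_mul M').mono'
      ((hcont p hp).rpow_const fun r => Or.inl (hpos p hp r).ne').aestronglyMeasurable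
      (ae_of_all _ fun r => ?_)
    rw [norm_of_nonneg (rpow_nonneg (hpos p hp r).le _)]
    exact hMb' p hp r
  have hI : ∀ p ∈ K, ∀ p' ∈ K, |(∫ r, k r p ^ (1 + α)) - ∫ r, k r p' ^ (1 + α)| ≤
      M' * π * ‖p - p'‖ := by
    intro p hp p' hp'
    rw [← integral_sub (hint p hp) (hint p' hp'), ← Real.norm_eq_abs]
    refine (norm_integral_le_of_norm_le
      ((integrable_inv_one_add_sq.const_mul M').mul_const ‖p - p'‖)
      (ae_of_all _ fun r => ?_)).trans_eq ?_
    · simpa using hMd' p hp p' hp' r r (by simp)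
    · rw [integral_mul_const, integral_const_mul, integral_univ_inv_one_add_sq]
  have hH : ∀ (t : V × E) (x : X) (y : ℝ), dpdH α (fun t x y => k (y - g x t.1) t.2) t x y =
      (∫ r, k r t.2 ^ (1 + α)) - (1 + 1 / α) * k (y - g x t.1) t.2 ^ α := by
    intro t x y
    unfold dpdH
    rw [integral_sub_right_eq_self (fun r => k r t.2 ^ (1 + α)) (g x t.1)]
  refine ⟨M' * π + (1 + 1 / α) * M * 2, fun θ hθ x y => ?_⟩
  refine norm_fderiv_le_of_lip' ℝ (by positivity) ?_
  have hθK : θ.2 ∈ K := mem_of_mem_nhds (hN _ hθ)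
  have hK : ∀ᶠ t in nhds θ, t.2 ∈ K := continuous_snd.continuousAt.eventually (hN _ hθ)
  have hclose : ∀ᶠ t in nhds θ, |g x t.1 - g x θ.1| < 1 := by
    have : Continuous fun t : V × E => |g x t.1 - g x θ.1| :=
      (((hg x).continuous.comp continuous_fst).sub continuous_const).abs
    exact this.continuousAt.eventually_lt continuousAt_const (by simp)
  have hgd : ∀ᶠ t in nhds θ,
      |g x t.1 - g x θ.1| ≤ (1 + ‖fderiv ℝ (g x) θ.1‖) * ‖t - θ‖ := by
    have h := (((hg x) θ.1).hasFDerivAt.isLittleO.def one_pos)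
    filter_upwards [continuous_fst.continuousAt.eventually h] with t ht
    have h1 : ‖t.1 - θ.1‖ ≤ ‖t - θ‖ := norm_fst_le (t - θ)
    have h2 := (fderiv ℝ (g x) θ.1).le_opNorm (t.1 - θ.1)
    have h3 : |g x t.1 - g x θ.1| ≤ ‖g x t.1 - g x θ.1 - fderiv ℝ (g x) θ.1 (t.1 - θ.1)‖ +
        ‖fderiv ℝ (g x) θ.1 (t.1 - θ.1)‖ := by
      simpa using norm_add_le (g x t.1 - g x θ.1 - fderiv ℝ (g x) θ.1 (t.1 - θ.1))
        (fderiv ℝ (g x) θ.1 (t.1 - θ.1))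
    calc |g x t.1 - g x θ.1| ≤ (1 + ‖fderiv ℝ (g x) θ.1‖) * ‖t.1 - θ.1‖ := by linarith
      _ ≤ _ := by gcongr
  filter_upwards [hK, hclose, hgd] with t htK htc htg
  have hsnd : ‖t.2 - θ.2‖ ≤ ‖t - θ‖ := norm_snd_le (t - θ)
  set G := ‖fderiv ℝ (g x) θ.1‖ with hG
  have hG0 : 0 ≤ G := norm_nonneg _
  set d := ‖t - θ‖ with hd
  have hd0 : 0 ≤ d := norm_nonneg _
  have hr : |(y - g x t.1) - (y - g x θ.1)| = |g x t.1 - g x θ.1| := by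
    rw [abs_sub_comm]
    congr 1
    ring
  have h1 : |k (y - g x t.1) t.2 ^ α - k (y - g x θ.1) θ.2 ^ α| ≤ M * (2 * (1 + G) * d) := by
    refine (hMd t.2 htK θ.2 hθK _ _ (hr.trans_le htc.le)).trans ?_
    rw [hr]
    have hinv : (1 + (y - g x t.1) ^ 2)⁻¹ ≤ 1 :=
      inv_le_one_of_one_le₀ (by nlinarith [sq_nonneg (y - g x t.1)])
    calc M * (1 + (y - g x t.1) ^ 2)⁻¹ * (|g x t.1 - g x θ.1| + ‖t.2 - θ.2‖)
        ≤ M * 1 * ((1 + G) * d + d) := by gcongr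
      _ ≤ M * (2 * (1 + G) * d) := by
        rw [mul_one]
        gcongr
        nlinarith
  have h2 : |(∫ r, k r t.2 ^ (1 + α)) - ∫ r, k r θ.2 ^ (1 + α)| ≤ M' * π * ((1 + G) * d) := by
    refine (hI t.2 htK θ.2 hθK).trans ?_
    gcongr
    nlinarith
  rw [hH, hH, Real.norm_eq_abs]
  have e : ∀ I I' u u' : ℝ, I - (1 + 1 / α) * u - (I' - (1 + 1 / α) * u') =
      (I - I') - (1 + 1 / α) * (u - u') := by
    intros
    ring
  rw [e]
  calc _ ≤ |(∫ r, k r t.2 ^ (1 + α)) - ∫ r, k r θ.2 ^ (1 + α)| +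
        |(1 + 1 / α) * (k (y - g x t.1) t.2 ^ α - k (y - g x θ.1) θ.2 ^ α)| := abs_sub _ _
    _ ≤ M' * π * ((1 + G) * d) + (1 + 1 / α) * (M * (2 * (1 + G) * d)) := by
      rw [abs_mul, abs_of_pos (by positivity : 0 < 1 + 1 / α)]
      gcongr
    _ = _ := by ring

/-- The kernel of the normal–truncated-normal density, as a function of the residual `r` and
`p = (μ, σ_v, σ_u)`. -/
noncomputable def kernelNT (r : ℝ) (p : ℝ × ℝ × ℝ) : ℝ :=
  (√(p.2.1 ^ 2 + p.2.2 ^ 2))⁻¹ * (1 - stdGaussCdf (-(p.1 / p.2.2)))⁻¹ *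
    stdGaussPdf ((r + p.1) / √(p.2.1 ^ 2 + p.2.2 ^ 2)) *
    stdGaussCdf (p.1 / (√(p.2.1 ^ 2 + p.2.2 ^ 2) * (p.2.2 / p.2.1)) -
      p.2.2 / p.2.1 * r / √(p.2.1 ^ 2 + p.2.2 ^ 2))

/-- The kernel of the normal–exponential density, as a function of the residual `r` and
`p = (σ_v, σ_u)`. -/
noncomputable def kernelNE (r : ℝ) (p : ℝ × ℝ) : ℝ :=
  p.2⁻¹ * stdGaussCdf (-(r / p.1) - p.1 / p.2) * exp (r / p.2 + p.1 ^ 2 / (2 * p.2 ^ 2))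

/-- The score bound on a compact parameter set for a location family whose kernel is log-quadratic
times a normal cdf of an affine function of the residual, and decays exponentially. -/
theorem exists_norm_fderiv_dpdH_le_of_eq_exp_mul_cdf {X V E : Type*} [NormedAddCommGroup V]
    [NormedSpace ℝ V] [NormedAddCommGroup E] [NormedSpace ℝ E] {g : X → V → ℝ}
    (hg : ∀ x, Differentiable ℝ (g x)) {α : ℝ} (hα : 0 < α) {K N : Set E} (hK : IsCompact K)
    (hN : ∀ p ∈ N, K ∈ nhds p) {c₀ c₁ c₂ a b : E → ℝ}
    (hc₀ : ∀ p ∈ K, ContDiffAt ℝ 1 c₀ p) (hc₁ : ∀ p ∈ K, ContDiffAt ℝ 1 c₁ p)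
    (hc₂ : ∀ p ∈ K, ContDiffAt ℝ 1 c₂ p) (ha : ∀ p ∈ K, ContDiffAt ℝ 1 a p)
    (hb : ∀ p ∈ K, ContDiffAt ℝ 1 b p) {k : ℝ → E → ℝ}
    (hk : ∀ p ∈ K, ∀ r, k r p =
      exp (c₀ p + c₁ p * r + c₂ p * r ^ 2) * stdGaussCdf (a p + b p * r))
    {B c : ℝ} (hc : 0 < c) (hdecay : ∀ p ∈ K, ∀ r, k r p ≤ B * exp (-(c * |r|))) :
    ∃ C : ℝ, ∀ θ : V × E, θ.2 ∈ N → ∀ (x : X) (y : ℝ),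
      ‖fderiv ℝ (fun t : V × E => dpdH α (fun t x y => k (y - g x t.1) t.2) t x y) θ‖ ≤
        C * (1 + ‖fderiv ℝ (g x) θ.1‖) := by
  obtain ⟨A, hA, hlog⟩ := exists_abs_log_sub_le hK hc₀ hc₁ hc₂ ha hb hk
  refine exists_norm_fderiv_dpdH_le hg hα hN (fun p hp r => ?_) (fun p hp => ?_) hc hdecay hA hlog
  · rw [hk p hp]
    exact mul_pos (exp_pos _) (stdGaussCdf_pos _)
  · simp_rw [hk p hp]
    have := contDiff_stdGaussCdf.continuous
    fun_prop

lemma kernelNT_eq {p : ℝ × ℝ × ℝ} (hv : 0 < p.2.1) (hu : 0 < p.2.2) (r : ℝ) :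
    kernelNT r p =
      exp ((log ((√(p.2.1 ^ 2 + p.2.2 ^ 2))⁻¹ * (1 - stdGaussCdf (-(p.1 / p.2.2)))⁻¹ *
          (√(2 * π))⁻¹) - p.1 ^ 2 / (2 * (p.2.1 ^ 2 + p.2.2 ^ 2))) +
        -(p.1 / (p.2.1 ^ 2 + p.2.2 ^ 2)) * r + -(1 / (2 * (p.2.1 ^ 2 + p.2.2 ^ 2))) * r ^ 2) *
      stdGaussCdf (p.1 / (√(p.2.1 ^ 2 + p.2.2 ^ 2) * (p.2.2 / p.2.1)) +
        -(p.2.2 / p.2.1 / √(p.2.1 ^ 2 + p.2.2 ^ 2)) * r) := by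
  have hs : 0 < p.2.1 ^ 2 + p.2.2 ^ 2 := by positivity
  have hΦ : 0 < 1 - stdGaussCdf (-(p.1 / p.2.2)) := sub_pos.2 (stdGaussCdf_lt_one _)
  have hpos : 0 < (√(p.2.1 ^ 2 + p.2.2 ^ 2))⁻¹ * (1 - stdGaussCdf (-(p.1 / p.2.2)))⁻¹ *
      (√(2 * π))⁻¹ := by positivity
  have e : ∀ l : ℝ, l - p.1 ^ 2 / (2 * (p.2.1 ^ 2 + p.2.2 ^ 2)) +
      -(p.1 / (p.2.1 ^ 2 + p.2.2 ^ 2)) * r + -(1 / (2 * (p.2.1 ^ 2 + p.2.2 ^ 2))) * r ^ 2 =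
      l + -((r + p.1) / √(p.2.1 ^ 2 + p.2.2 ^ 2)) ^ 2 / 2 := by
    intro l
    rw [div_pow, sq_sqrt hs.le]
    field_simp
    ring
  rw [e, exp_add, exp_log hpos]
  unfold kernelNT stdGaussPdf
  rw [show p.1 / (√(p.2.1 ^ 2 + p.2.2 ^ 2) * (p.2.2 / p.2.1)) -
      p.2.2 / p.2.1 * r / √(p.2.1 ^ 2 + p.2.2 ^ 2) =
      p.1 / (√(p.2.1 ^ 2 + p.2.2 ^ 2) * (p.2.2 / p.2.1)) +
        -(p.2.2 / p.2.1 / √(p.2.1 ^ 2 + p.2.2 ^ 2)) * r by ring]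
  ring

lemma kernelNE_eq {p : ℝ × ℝ} (hu : 0 < p.2) (r : ℝ) :
    kernelNE r p =
      exp ((log p.2⁻¹ + p.1 ^ 2 / (2 * p.2 ^ 2)) + p.2⁻¹ * r + 0 * r ^ 2) *
      stdGaussCdf (-(p.1 / p.2) + -p.1⁻¹ * r) := by
  have e : log p.2⁻¹ + p.1 ^ 2 / (2 * p.2 ^ 2) + p.2⁻¹ * r + 0 * r ^ 2 =
      log p.2⁻¹ + (r / p.2 + p.1 ^ 2 / (2 * p.2 ^ 2)) := by ring
  rw [e, exp_add, exp_log (inv_pos.2 hu)]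
  unfold kernelNE
  rw [show -(r / p.1) - p.1 / p.2 = -(p.1 / p.2) + -p.1⁻¹ * r by ring]
  ring

lemma exists_norm_fderiv_dpdH_fNT_le {n q : ℕ} {g : (Fin n → ℝ) → (Fin q → ℝ) → ℝ}
    (hg : ∀ x, Differentiable ℝ (g x)) {α : ℝ} (hα : 0 < α) (bl bu ul uu : ℝ) {sl : ℝ} (su : ℝ)
    (hsl : 0 < sl) :
    ∃ C : ℝ, ∀ θ ∈ boxNT q bl bu ul uu sl su, ∀ (x : Fin n → ℝ) (y : ℝ),
      ‖fderiv ℝ (fun t => dpdH α (fNT g) t x y) θ‖ ≤ C * (1 + ‖fderiv ℝ (g x) θ.1‖) := by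
  set J : Set ℝ := Icc (sl / 2) (su + 1) with hJ
  set K : Set (ℝ × ℝ × ℝ) := Icc (ul - 1) (uu + 1) ×ˢ (J ×ˢ J) with hK
  have hKc : IsCompact K := isCompact_Icc.prod (isCompact_Icc.prod isCompact_Icc)
  have hJn : ∀ s ∈ Icc sl su, J ∈ nhds s := fun s hs =>
    Icc_mem_nhds (by linarith [hs.1]) (by linarith [hs.2])
  have hN : ∀ p ∈ Icc ul uu ×ˢ (Icc sl su ×ˢ Icc sl su), K ∈ nhds p := fun p hp =>
    prod_mem_nhds (Icc_mem_nhds (by linarith [hp.1.1]) (by linarith [hp.1.2]))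
      (prod_mem_nhds (hJn _ hp.2.1) (hJn _ hp.2.2))
  have hv : ∀ p ∈ K, 0 < p.2.1 := fun p hp => by linarith [hp.2.1.1]
  have hu : ∀ p ∈ K, 0 < p.2.2 := fun p hp => by linarith [hp.2.2.1]
  set c₀ : ℝ × ℝ × ℝ → ℝ := fun p =>
    log ((√(p.2.1 ^ 2 + p.2.2 ^ 2))⁻¹ * (1 - stdGaussCdf (-(p.1 / p.2.2)))⁻¹ *
      (√(2 * π))⁻¹) - p.1 ^ 2 / (2 * (p.2.1 ^ 2 + p.2.2 ^ 2)) with hc₀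
  set c₁ : ℝ × ℝ × ℝ → ℝ := fun p => -(p.1 / (p.2.1 ^ 2 + p.2.2 ^ 2)) with hc₁
  have hc₀' : ∀ p ∈ K, ContDiffAt ℝ 1 c₀ p := by
    intro p hp
    have h1 := hv p hp
    have h2 := hu p hp
    have h3 : 0 < p.2.1 ^ 2 + p.2.2 ^ 2 := by positivity
    have h4 : 0 < 1 - stdGaussCdf (-(p.1 / p.2.2)) := sub_pos.2 (stdGaussCdf_lt_one _)
    rw [hc₀]
    fun_prop (disch := positivity)
  have hc₁' : ∀ p ∈ K, ContDiffAt ℝ 1 c₁ p := by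
    intro p hp
    have h1 := hv p hp
    rw [hc₁]
    fun_prop (disch := positivity)
  obtain ⟨L₀, hL₀, hB₀, -⟩ := exists_lipschitz_bounded hKc hc₀'
  obtain ⟨L₁, hL₁, hB₁, -⟩ := exists_lipschitz_bounded hKc hc₁'
  have hdecay : ∀ p ∈ K, ∀ r, kernelNT r p ≤
      exp (L₀ + (L₁ + 1) ^ 2 * (su + 1) ^ 2) * exp (-(1 * |r|)) := by
    intro p hp r
    have h1 := hv p hp
    have h2 := hu p hp
    have h3 : 0 < p.2.1 ^ 2 + p.2.2 ^ 2 := by positivity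
    have h4 : p.2.1 ^ 2 + p.2.2 ^ 2 ≤ 2 * (su + 1) ^ 2 := by
      nlinarith [hp.2.1.2, hp.2.2.2]
    have hS : 0 < su + 1 := h1.trans_le hp.2.1.2
    rw [kernelNT_eq h1 h2, ← exp_add]
    refine (mul_le_of_le_one_right (exp_pos _).le (stdGaussCdf_lt_one _).le).trans
      (exp_le_exp.2 ?_)
    have h5 : c₀ p ≤ L₀ := (le_abs_self _).trans (hB₀ p hp)
    have h6 : c₁ p * r ≤ L₁ * |r| := by
      calc c₁ p * r ≤ |c₁ p| * |r| := by rw [← abs_mul]; exact le_abs_self _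
        _ ≤ _ := by gcongr; exact hB₁ p hp
    have h7 : 1 / (4 * (su + 1) ^ 2) * |r| ^ 2 ≤
        1 / (2 * (p.2.1 ^ 2 + p.2.2 ^ 2)) * r ^ 2 := by
      rw [sq_abs]
      exact mul_le_mul_of_nonneg_right
        (one_div_le_one_div_of_le (by positivity) (by linarith)) (sq_nonneg r)
    have h8 : (L₁ + 1) * |r| ≤ (L₁ + 1) ^ 2 * (su + 1) ^ 2 + 1 / (4 * (su + 1) ^ 2) * |r| ^ 2 := by
      have h := sq_nonneg ((L₁ + 1) * (su + 1) - |r| / (2 * (su + 1)))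
      have e : ((L₁ + 1) * (su + 1) - |r| / (2 * (su + 1))) ^ 2 =
          (L₁ + 1) ^ 2 * (su + 1) ^ 2 + 1 / (4 * (su + 1) ^ 2) * |r| ^ 2 - (L₁ + 1) * |r| := by
        field_simp
        ring
      linarith
    linarith
  obtain ⟨C, hC⟩ := exists_norm_fderiv_dpdH_le_of_eq_exp_mul_cdf hg hα hKc hN
    (c₀ := c₀) (c₁ := c₁) hc₀' hc₁'
    (c₂ := fun p => -(1 / (2 * (p.2.1 ^ 2 + p.2.2 ^ 2))))
    (a := fun p => p.1 / (√(p.2.1 ^ 2 + p.2.2 ^ 2) * (p.2.2 / p.2.1)))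
    (b := fun p => -(p.2.2 / p.2.1 / √(p.2.1 ^ 2 + p.2.2 ^ 2)))
    (fun p hp => by
      have h1 := hv p hp
      fun_prop (disch := positivity))
    (fun p hp => by
      have h1 := hv p hp
      have h2 := hu p hp
      fun_prop (disch := positivity))
    (fun p hp => by
      have h1 := hv p hp
      fun_prop (disch := positivity))
    (fun p hp r => kernelNT_eq (hv p hp) (hu p hp) r) one_pos hdecay
  exact ⟨C, fun θ hθ x y => hC θ hθ.2 x y⟩

lemma kernelNE_le {p : ℝ × ℝ} {S : ℝ} (hv : 0 < p.1) (hu : 0 < p.2) (hvS : p.1 ≤ S)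
    (huS : p.2 ≤ S) (r : ℝ) :
    kernelNE r p ≤ exp (log p.2⁻¹ + p.1 ^ 2 / (2 * p.2 ^ 2) + 1 / 2) * exp (-(S⁻¹ * |r|)) := by
  have hS : 0 < S := hv.trans_le hvS
  rw [kernelNE_eq hu, ← exp_add]
  rcases le_total 0 r with hr | hr
  · have hz : -(p.1 / p.2) + -p.1⁻¹ * r ≤ 0 := by
      have : 0 ≤ p.1 / p.2 + p.1⁻¹ * r := by positivity
      linarith
    refine (mul_le_mul_of_nonneg_left (stdGaussCdf_le_exp hz) (exp_pos _).le).trans ?_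
    rw [← exp_add, abs_of_nonneg hr]
    refine exp_le_exp.2 ?_
    have e : (-(p.1 / p.2) + -p.1⁻¹ * r) ^ 2 =
        p.1 ^ 2 / p.2 ^ 2 + 2 * (p.2⁻¹ * r) + (p.1⁻¹ * r) ^ 2 := by
      field_simp
      ring
    have h1 : (S⁻¹ * r) ^ 2 ≤ (p.1⁻¹ * r) ^ 2 := by gcongr
    have h2 : p.1 ^ 2 / (2 * p.2 ^ 2) = p.1 ^ 2 / p.2 ^ 2 / 2 := by ring
    have h3 : 0 ≤ p.1 ^ 2 / (2 * p.2 ^ 2) := by positivity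
    rw [e]
    nlinarith [sq_nonneg (S⁻¹ * r - 1)]
  · refine (mul_le_of_le_one_right (exp_pos _).le (stdGaussCdf_lt_one _).le).trans
      (exp_le_exp.2 ?_)
    rw [abs_of_nonpos hr]
    have h1 : S⁻¹ * -r ≤ p.2⁻¹ * -r :=
      mul_le_mul_of_nonneg_right (inv_anti₀ hu huS) (by linarith)
    linarith

lemma exists_norm_fderiv_dpdH_fNE_le {n q : ℕ} {g : (Fin n → ℝ) → (Fin q → ℝ) → ℝ}
    (hg : ∀ x, Differentiable ℝ (g x)) {α : ℝ} (hα : 0 < α) (bl bu : ℝ) {sl su : ℝ}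
    (hsl : 0 < sl) (hs : sl ≤ su) :
    ∃ C : ℝ, ∀ θ ∈ boxNE q bl bu sl su, ∀ (x : Fin n → ℝ) (y : ℝ),
      ‖fderiv ℝ (fun t => dpdH α (fNE g) t x y) θ‖ ≤ C * (1 + ‖fderiv ℝ (g x) θ.1‖) := by
  set J : Set ℝ := Icc (sl / 2) (su + 1) with hJ
  set K : Set (ℝ × ℝ) := J ×ˢ J with hK
  have hKc : IsCompact K := isCompact_Icc.prod isCompact_Icc
  have hJn : ∀ s ∈ Icc sl su, J ∈ nhds s := fun s hs =>
    Icc_mem_nhds (by linarith [hs.1]) (by linarith [hs.2])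
  have hN : ∀ p ∈ Icc sl su ×ˢ Icc sl su, K ∈ nhds p := fun p hp =>
    prod_mem_nhds (hJn _ hp.1) (hJn _ hp.2)
  have hv : ∀ p ∈ K, 0 < p.1 := fun p hp => by linarith [hp.1.1]
  have hu : ∀ p ∈ K, 0 < p.2 := fun p hp => by linarith [hp.2.1]
  set c₀ : ℝ × ℝ → ℝ := fun p => log p.2⁻¹ + p.1 ^ 2 / (2 * p.2 ^ 2) with hc₀
  have hc₀' : ∀ p ∈ K, ContDiffAt ℝ 1 c₀ p := by
    intro p hp
    have h1 := hu p hp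
    rw [hc₀]
    fun_prop (disch := positivity)
  obtain ⟨L₀, hL₀, hB₀, -⟩ := exists_lipschitz_bounded hKc hc₀'
  have hdecay : ∀ p ∈ K, ∀ r,
      kernelNE r p ≤ exp (L₀ + 1 / 2) * exp (-((su + 1)⁻¹ * |r|)) := by
    intro p hp r
    refine (kernelNE_le (hv p hp) (hu p hp) hp.1.2 hp.2.2 r).trans ?_
    gcongr
    exact (le_abs_self _).trans (hB₀ p hp)
  obtain ⟨C, hC⟩ := exists_norm_fderiv_dpdH_le_of_eq_exp_mul_cdf hg hα hKc hN
    (c₀ := c₀) (c₁ := fun p => p.2⁻¹) (c₂ := fun _ => 0) (a := fun p => -(p.1 / p.2))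
    (b := fun p => -p.1⁻¹) hc₀'
    (fun p hp => by
      have h1 := hu p hp
      fun_prop (disch := positivity))
    (fun _ _ => contDiffAt_const)
    (fun p hp => by
      have h1 := hu p hp
      fun_prop (disch := positivity))
    (fun p hp => by
      have h1 := hv p hp
      fun_prop (disch := positivity))
    (fun p hp r => kernelNE_eq (hu p hp) r) (inv_pos.2 (by linarith)) hdecay
  exact ⟨C, fun θ hθ x y => hC θ hθ.2 x y⟩

/-- Proposition 2: for the normal–truncated-normal and the
normal–exponential pseudo conditional densities, with Θ the compact box and g(x,β)
differentiable in β, for every α > 0 there is a constant C independent of x, y, θ with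
‖∂_θ H_α(x,y;θ)‖ ≤ C (1 + ‖∂_β g(x,β)‖) for all θ ∈ Θ and all (x,y). -/
theorem score_of_H_alpha_bound {p q : ℕ} (g : (Fin p → ℝ) → (Fin q → ℝ) → ℝ)
    (hg : ∀ x, Differentiable ℝ (g x))
    (a : ℝ) (ha : 0 < a)
    (bl bu ul uu sl su : ℝ) (hsl : 0 < sl) (hs : sl ≤ su) :
    (∃ C : ℝ, ∀ θ ∈ boxNT q bl bu ul uu sl su, ∀ (x : Fin p → ℝ) (y : ℝ),
        ‖fderiv ℝ (fun t => dpdH a (fNT g) t x y) θ‖ ≤ C * (1 + ‖fderiv ℝ (g x) θ.1‖))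
    ∧ (∃ C : ℝ, ∀ θ ∈ boxNE q bl bu sl su, ∀ (x : Fin p → ℝ) (y : ℝ),
        ‖fderiv ℝ (fun t => dpdH a (fNE g) t x y) θ‖ ≤ C * (1 + ‖fderiv ℝ (g x) θ.1‖)) := by
  exact ⟨exists_norm_fderiv_dpdH_fNT_le hg ha bl bu ul uu su hsl,
    exists_norm_fderiv_dpdH_fNE_le hg ha bl bu hsl hs⟩
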